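/- arXiv:2307.03074 — 5 statements merged into one kernel-verified Lean document; each statement's English description precedes it below -/
import Mathlib

section
/- Let K ≥ 1, let Σ_ε be a real symmetric K×K matrix with c₁ I ≼ Σ_ε ≼ c₂ I for constants 0 < c₁ ≤ c₂, let A be a real K×K matrix with ‖A‖_op ≤ a for some a < 1, and set Γ := ∑_{s=0}^∞ A^s Σ_ε (Aᵀ)^s. Form the 2K×2K block matrix Σ = [[Γ, AΓ],[ΓAᵀ, Γ]]. Then: (i) for every x = (x₁, x₂) ∈ ℝ^K × ℝ^K one has the identity xᵀ Σ x = x₁ᵀ Σ_ε x₁ + (Aᵀx₁ + x₂)ᵀ Γ (Aᵀx₁ + x₂); (ii) Σ is symmetric positive definite; (iii) ‖Σ‖_op ≤ 3 c₂/(1−a²); and (iv) the smallest eigenvalue of Σ is at least c₁ · (2 + a² − a√(a² + 4))/2. -/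
open Matrix

/-- The ℓ²→ℓ² operator norm of a real square matrix (its largest singular value). -/
noncomputable def opNorm {n : Type*} [Fintype n] [DecidableEq n] (A : Matrix n n ℝ) : ℝ :=
  ‖Matrix.toEuclideanCLM (𝕜 := ℝ) A‖

/-- The stationary covariance `Γ = ∑_{s≥0} A^s Σε (Aᵀ)^s`. -/
noncomputable def GammaSum {K : ℕ} (A Se : Matrix (Fin K) (Fin K) ℝ) :
    Matrix (Fin K) (Fin K) ℝ :=
  ∑' s : ℕ, A ^ s * Se * Aᵀ ^ s

/-- The block matrix `Σ = [[Γ, AΓ],[ΓAᵀ, Γ]]`. -/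
noncomputable def SigmaBlock {K : ℕ} (A Se : Matrix (Fin K) (Fin K) ℝ) :
    Matrix (Fin K ⊕ Fin K) (Fin K ⊕ Fin K) ℝ :=
  Matrix.fromBlocks (GammaSum A Se) (A * GammaSum A Se) (GammaSum A Se * Aᵀ) (GammaSum A Se)


lemma dot_self_eq {n : Type*} [Fintype n] (x : n → ℝ) :
    x ⬝ᵥ x = ‖(WithLp.toLp 2 x : EuclideanSpace ℝ n)‖ ^ 2 := by
  rw [EuclideanSpace.real_norm_sq_eq]
  simp [dotProduct, sq]

lemma dot_self_nn {n : Type*} [Fintype n] (x : n → ℝ) : 0 ≤ x ⬝ᵥ x := by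
  rw [dot_self_eq]; positivity

lemma mulVec_bound {n : Type*} [Fintype n] [DecidableEq n] (A : Matrix n n ℝ) (a : ℝ)
    (ha : opNorm A ≤ a) (x : n → ℝ) : (A *ᵥ x) ⬝ᵥ (A *ᵥ x) ≤ a ^ 2 * (x ⬝ᵥ x) := by
  rw [dot_self_eq, dot_self_eq, ← mul_pow]
  have := (Matrix.toEuclideanCLM (𝕜 := ℝ) A).le_of_opNorm_le ha (WithLp.toLp 2 x)
  rw [Matrix.toEuclideanCLM_toLp] at this
  gcongr

lemma opNorm_bound {n : Type*} [Fintype n] [DecidableEq n] (A : Matrix n n ℝ) (a : ℝ)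
    (ha : 0 ≤ a) (h : ∀ x, (A *ᵥ x) ⬝ᵥ (A *ᵥ x) ≤ a ^ 2 * (x ⬝ᵥ x)) : opNorm A ≤ a := by
  refine ContinuousLinearMap.opNorm_le_bound _ ha fun x => ?_
  have := h (WithLp.ofLp x)
  rw [dot_self_eq, dot_self_eq, ← mul_pow] at this
  exact (sq_le_sq₀ (norm_nonneg _) (by positivity)).1 this

lemma dot_symm {n : Type*} [Fintype n] (M : Matrix n n ℝ) (hM : Mᵀ = M)
    (x y : n → ℝ) : x ⬝ᵥ M *ᵥ y = y ⬝ᵥ M *ᵥ x := by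
  rw [dotProduct_mulVec, ← mulVec_transpose, hM, dotProduct_comm]

lemma opNorm_quad {n : Type*} [Fintype n] [DecidableEq n] (M : Matrix n n ℝ) (C : ℝ)
    (hC : 0 < C) (hM : Mᵀ = M) (h0 : ∀ x, 0 ≤ x ⬝ᵥ M *ᵥ x)
    (h1 : ∀ x, x ⬝ᵥ M *ᵥ x ≤ C * (x ⬝ᵥ x)) : opNorm M ≤ C := by
  refine opNorm_bound M C hC.le fun x => ?_
  have e1 := h1 (C • x + M *ᵥ x)
  have e2 := h0 (C • x - M *ᵥ x)
  have e3 := dot_symm M hM x (M *ᵥ x)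
  have e4 := h1 (C • x - M *ᵥ x)
  have e5 := dotProduct_comm x (M *ᵥ x)
  have e6 := h0 (M *ᵥ x)
  have e7 := h1 x
  have e8 := h1 (M *ᵥ x)
  simp only [mulVec_add, mulVec_sub, mulVec_smul, dotProduct_add, dotProduct_sub, add_dotProduct,
    sub_dotProduct, smul_dotProduct, dotProduct_smul, smul_eq_mul] at *
  set p := (M *ᵥ x) ⬝ᵥ (M *ᵥ x)
  set q := x ⬝ᵥ x
  set r := x ⬝ᵥ M *ᵥ x
  set t := (M *ᵥ x) ⬝ᵥ M *ᵥ M *ᵥ x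
  rw [e3, ← e5] at *
  have : C * p ≤ C * (C ^ 2 * q) := by nlinarith [mul_le_mul_of_nonneg_left e7 (sq_nonneg C)]
  exact le_of_mul_le_mul_left this hC

lemma opNorm_transpose {n : Type*} [Fintype n] [DecidableEq n] (A : Matrix n n ℝ) :
    opNorm Aᵀ = opNorm A := by
  have := Matrix.l2_opNorm_conjTranspose A
  rwa [Matrix.conjTranspose_eq_transpose_of_trivial] at this

open scoped Matrix.Norms.L2Operator in
lemma gamma_summable {K : ℕ} (Se A : Matrix (Fin K) (Fin K) ℝ) (a : ℝ)
    (ha : opNorm A ≤ a) (ha1 : a < 1) : Summable fun s : ℕ => A ^ s * Se * Aᵀ ^ s := by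
  have h0 : 0 ≤ a := (norm_nonneg _).trans ha
  have hA : ‖A‖ ≤ a := ha
  have hA' : ‖Aᵀ‖ ≤ a := (opNorm_transpose A).le.trans ha
  have hg : Summable fun s : ℕ => (a ^ 2) ^ s * ‖Se‖ :=
    (summable_geometric_of_lt_one (by positivity) (by nlinarith)).mul_right _
  refine Summable.of_norm_bounded_eventually_nat hg ?_
  filter_upwards [Filter.eventually_ge_atTop 1] with s hs
  calc ‖A ^ s * Se * Aᵀ ^ s‖ ≤ ‖A ^ s‖ * ‖Se‖ * ‖Aᵀ ^ s‖ :=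
        (norm_mul_le _ _).trans (by gcongr; exact norm_mul_le _ _)
    _ ≤ a ^ s * ‖Se‖ * a ^ s := by
        have e1 : ‖A ^ s‖ ≤ a ^ s :=
          (norm_pow_le' A hs).trans (pow_le_pow_left₀ (norm_nonneg _) hA s)
        have e2 : ‖Aᵀ ^ s‖ ≤ a ^ s :=
          (norm_pow_le' Aᵀ hs).trans (pow_le_pow_left₀ (norm_nonneg _) hA' s)
        gcongr
    _ = (a ^ 2) ^ s * ‖Se‖ := by ring

lemma gamma_fix {K : ℕ} (Se A : Matrix (Fin K) (Fin K) ℝ)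
    (hs : Summable fun s : ℕ => A ^ s * Se * Aᵀ ^ s) :
    GammaSum A Se = Se + A * GammaSum A Se * Aᵀ := by
  unfold GammaSum
  conv_lhs => rw [hs.tsum_eq_zero_add]
  rw [← hs.tsum_mul_left, ← (hs.mul_left A).tsum_mul_right]
  congr 1
  · simp
  · refine tsum_congr fun s => ?_
    rw [pow_succ' A, pow_succ Aᵀ]
    simp only [Matrix.mul_assoc]

lemma gamma_symm {K : ℕ} (Se A : Matrix (Fin K) (Fin K) ℝ) (h : Seᵀ = Se) :
    (GammaSum A Se)ᵀ = GammaSum A Se := by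
  unfold GammaSum
  rw [Matrix.transpose_tsum]
  refine tsum_congr fun s => ?_
  simp [Matrix.transpose_mul, Matrix.transpose_pow, h, Matrix.mul_assoc]

lemma dot_conj {n : Type*} [Fintype n] (B M : Matrix n n ℝ) (x y : n → ℝ) :
    x ⬝ᵥ (B * M) *ᵥ y = (Bᵀ *ᵥ x) ⬝ᵥ M *ᵥ y := by
  rw [← mulVec_mulVec, dotProduct_mulVec x B, mulVec_transpose]

lemma gamma_hasSum {K : ℕ} (Se A : Matrix (Fin K) (Fin K) ℝ)
    (hs : Summable fun s : ℕ => A ^ s * Se * Aᵀ ^ s) (x : Fin K → ℝ) :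
    HasSum (fun s : ℕ => (Aᵀ ^ s *ᵥ x) ⬝ᵥ Se *ᵥ (Aᵀ ^ s *ᵥ x)) (x ⬝ᵥ GammaSum A Se *ᵥ x) := by
  let f : Matrix (Fin K) (Fin K) ℝ →+ ℝ :=
    { toFun := fun M => x ⬝ᵥ M *ᵥ x
      map_zero' := by simp
      map_add' := fun M N => by simp [add_mulVec, dotProduct_add] }
  have hf : Continuous f := by
    change Continuous fun M : Matrix (Fin K) (Fin K) ℝ => x ⬝ᵥ M *ᵥ x
    fun_prop
  have := hs.hasSum.map f hf
  suffices e : (fun s : ℕ => (Aᵀ ^ s *ᵥ x) ⬝ᵥ Se *ᵥ (Aᵀ ^ s *ᵥ x)) =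
      f ∘ fun s : ℕ => A ^ s * Se * Aᵀ ^ s by
    rw [e]; exact this
  funext s
  change _ = x ⬝ᵥ (A ^ s * Se * Aᵀ ^ s) *ᵥ x
  rw [Matrix.mul_assoc, dot_conj, Matrix.transpose_pow, mulVec_mulVec]

lemma pow_bound {K : ℕ} (B : Matrix (Fin K) (Fin K) ℝ) (a : ℝ)
    (h : ∀ x, (B *ᵥ x) ⬝ᵥ (B *ᵥ x) ≤ a ^ 2 * (x ⬝ᵥ x)) (s : ℕ) (x : Fin K → ℝ) :
    (B ^ s *ᵥ x) ⬝ᵥ (B ^ s *ᵥ x) ≤ (a ^ 2) ^ s * (x ⬝ᵥ x) := by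
  induction s with
  | zero => simp
  | succ s ih =>
    rw [pow_succ', ← mulVec_mulVec]
    refine (h _).trans ?_
    rw [pow_succ' (a ^ 2), mul_assoc]
    gcongr

lemma scalar_root (a : ℝ) (h0 : 0 ≤ a) :
    let l := (2 + a ^ 2 - a * Real.sqrt (a ^ 2 + 4)) / 2
    0 < l ∧ l ≤ 1 ∧ (1 - l) ^ 2 = l * a ^ 2 := by
  intro l
  have hs := Real.sq_sqrt (show 0 ≤ a ^ 2 + 4 by positivity)
  have hn := Real.sqrt_nonneg (a ^ 2 + 4)
  have hl : l = (2 + a ^ 2 - a * Real.sqrt (a ^ 2 + 4)) / 2 := rfl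
  set r := Real.sqrt (a ^ 2 + 4)
  have hr : a ≤ r := by nlinarith
  have har : 0 ≤ a * r := by positivity
  refine ⟨?_, ?_, ?_⟩
  · have e : l * (2 + a ^ 2 + a * r) = 2 := by
      rw [hl]; linear_combination (-a ^ 2 / 2) * hs
    by_contra hc
    nlinarith [sq_nonneg a]
  · rw [hl]; nlinarith
  · rw [hl]; linear_combination (a ^ 2 / 4) * hs

lemma lower_vec {n : Type*} [Fintype n] (a l q : ℝ) (u y : n → ℝ) (hl0 : 0 < l) (hl1 : l ≤ 1)
    (hl : (1 - l) ^ 2 = l * a ^ 2) (hu : u ⬝ᵥ u ≤ a ^ 2 * q) :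
    l * (q + y ⬝ᵥ y) ≤ q + (u + y) ⬝ᵥ (u + y) := by
  rcases hl1.lt_or_eq with h | h
  · have e := dot_self_nn ((1 - l) • y + u)
    have c := dotProduct_comm u y
    simp only [dotProduct_add, add_dotProduct, smul_dotProduct, dotProduct_smul, smul_eq_mul] at *
    rw [c] at *
    have h2 : l * (u ⬝ᵥ u) ≤ (1 - l) ^ 2 * q := by
      rw [hl, mul_assoc]; gcongr
    have : 0 ≤ (1 - l) * (q + (u ⬝ᵥ u + y ⬝ᵥ u + (y ⬝ᵥ u + y ⬝ᵥ y)) - l * (q + y ⬝ᵥ y)) := by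
      nlinarith
    have := nonneg_of_mul_nonneg_right this (by linarith)
    linarith
  · subst h
    have ha : a ^ 2 = 0 := by linarith
    rw [ha, zero_mul] at hu
    have : u = 0 := by
      rw [← dotProduct_self_eq_zero]; exact le_antisymm hu (dot_self_nn u)
    simp [this]

/-- With `c₁ I ≼ Σε ≼ c₂ I`, `0 < c₁ ≤ c₂`, `‖A‖_op ≤ a < 1`,
`Γ = ∑_{s≥0} A^s Σε (Aᵀ)^s` and `Σ = [[Γ, AΓ],[ΓAᵀ, Γ]]`:
(i) `xᵀ Σ x = x₁ᵀ Σε x₁ + (Aᵀx₁+x₂)ᵀ Γ (Aᵀx₁+x₂)`;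
(ii) `Σ` is symmetric positive definite; (iii) `‖Σ‖_op ≤ 3c₂/(1-a²)`;
(iv) the smallest eigenvalue of `Σ` is at least `c₁ (2 + a² - a√(a²+4))/2`. -/
theorem stmt3 (K : ℕ) (hK : 1 ≤ K) (Se A : Matrix (Fin K) (Fin K) ℝ)
    (c₁ c₂ a : ℝ) (hc₁ : 0 < c₁) (hc₁₂ : c₁ ≤ c₂)
    (hSymm : Se.IsHermitian)
    (hlo : (Se - c₁ • (1 : Matrix (Fin K) (Fin K) ℝ)).PosSemidef)
    (hhi : ((c₂ • (1 : Matrix (Fin K) (Fin K) ℝ)) - Se).PosSemidef)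
    (ha : opNorm A ≤ a) (ha1 : a < 1) :
    (∀ x₁ x₂ : Fin K → ℝ,
        Sum.elim x₁ x₂ ⬝ᵥ (SigmaBlock A Se) *ᵥ Sum.elim x₁ x₂ =
          x₁ ⬝ᵥ Se *ᵥ x₁ +
            (Aᵀ *ᵥ x₁ + x₂) ⬝ᵥ (GammaSum A Se) *ᵥ (Aᵀ *ᵥ x₁ + x₂)) ∧
      (SigmaBlock A Se).PosDef ∧
      opNorm (SigmaBlock A Se) ≤ 3 * c₂ / (1 - a ^ 2) ∧
      (∀ (h : (SigmaBlock A Se).IsHermitian) (i : Fin K ⊕ Fin K),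
        c₁ * ((2 + a ^ 2 - a * Real.sqrt (a ^ 2 + 4)) / 2) ≤ h.eigenvalues i) := by
  have h0 : 0 ≤ a := (norm_nonneg _).trans ha
  have ha2 : 0 < 1 - a ^ 2 := by nlinarith
  have hc₂ : 0 < c₂ := hc₁.trans_le hc₁₂
  have hSt : Seᵀ = Se := by
    rw [← Matrix.conjTranspose_eq_transpose_of_trivial]; exact hSymm
  have hs := gamma_summable Se A a ha ha1
  have hfix := gamma_fix Se A hs
  have hGt := gamma_symm Se A hSt
  have hAt : ∀ x, (Aᵀ *ᵥ x) ⬝ᵥ (Aᵀ *ᵥ x) ≤ a ^ 2 * (x ⬝ᵥ x) :=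
    mulVec_bound Aᵀ a ((opNorm_transpose A).le.trans ha)
  have hSlo : ∀ x, c₁ * (x ⬝ᵥ x) ≤ x ⬝ᵥ Se *ᵥ x := fun x => by
    have := hlo.dotProduct_mulVec_nonneg x
    simp [sub_mulVec, smul_mulVec, dotProduct_sub] at this
    linarith
  have hShi : ∀ x, x ⬝ᵥ Se *ᵥ x ≤ c₂ * (x ⬝ᵥ x) := fun x => by
    have := hhi.dotProduct_mulVec_nonneg x
    simp [sub_mulVec, smul_mulVec, dotProduct_sub] at this
    linarith
  have hS0 : ∀ x, 0 ≤ x ⬝ᵥ Se *ᵥ x := fun x =>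
    (mul_nonneg hc₁.le (dot_self_nn x)).trans (hSlo x)
  have hG0 : ∀ x, 0 ≤ x ⬝ᵥ GammaSum A Se *ᵥ x := fun x =>
    (gamma_hasSum Se A hs x).nonneg fun s => hS0 _
  have hGhi : ∀ x, x ⬝ᵥ GammaSum A Se *ᵥ x ≤ c₂ / (1 - a ^ 2) * (x ⬝ᵥ x) := fun x => by
    have hg := ((hasSum_geometric_of_lt_one (sq_nonneg a) (by linarith)).mul_left c₂).mul_right
      (x ⬝ᵥ x)
    rw [div_eq_mul_inv]
    refine hasSum_le (fun s => ?_) (gamma_hasSum Se A hs x) hg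
    refine (hShi _).trans ?_
    rw [mul_assoc]
    have := pow_bound Aᵀ a hAt s x
    gcongr
  have hfixq : ∀ x, x ⬝ᵥ GammaSum A Se *ᵥ x =
      x ⬝ᵥ Se *ᵥ x + (Aᵀ *ᵥ x) ⬝ᵥ GammaSum A Se *ᵥ (Aᵀ *ᵥ x) := fun x => by
    conv_lhs => rw [hfix]
    rw [add_mulVec, dotProduct_add, Matrix.mul_assoc, dot_conj, mulVec_mulVec]
  have hGlo : ∀ x, c₁ * (x ⬝ᵥ x) ≤ x ⬝ᵥ GammaSum A Se *ᵥ x := fun x => by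
    rw [hfixq]; linarith [hSlo x, hG0 (Aᵀ *ᵥ x)]
  have hexp : ∀ x₁ x₂ : Fin K → ℝ,
      Sum.elim x₁ x₂ ⬝ᵥ (SigmaBlock A Se) *ᵥ Sum.elim x₁ x₂ =
        x₁ ⬝ᵥ GammaSum A Se *ᵥ x₁ + 2 * ((Aᵀ *ᵥ x₁) ⬝ᵥ GammaSum A Se *ᵥ x₂) +
          x₂ ⬝ᵥ GammaSum A Se *ᵥ x₂ := fun x₁ x₂ => by
    rw [SigmaBlock, fromBlocks_mulVec, sumElim_dotProduct_sumElim]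
    simp only [Sum.elim_comp_inl, Sum.elim_comp_inr, dotProduct_add]
    rw [dot_conj, ← mulVec_mulVec, dot_symm _ hGt x₂ (Aᵀ *ᵥ x₁)]
    ring
  have hi : ∀ x₁ x₂ : Fin K → ℝ,
      Sum.elim x₁ x₂ ⬝ᵥ (SigmaBlock A Se) *ᵥ Sum.elim x₁ x₂ =
        x₁ ⬝ᵥ Se *ᵥ x₁ +
          (Aᵀ *ᵥ x₁ + x₂) ⬝ᵥ (GammaSum A Se) *ᵥ (Aᵀ *ᵥ x₁ + x₂) := fun x₁ x₂ => by
    rw [hexp, hfixq x₁]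
    simp only [mulVec_add, dotProduct_add, add_dotProduct]
    rw [dot_symm _ hGt x₂ (Aᵀ *ᵥ x₁)]
    ring
  have hSigt : (SigmaBlock A Se)ᵀ = SigmaBlock A Se := by
    simp [SigmaBlock, Matrix.fromBlocks_transpose, hGt]
  have hsplit : ∀ x : Fin K ⊕ Fin K → ℝ, x = Sum.elim (x ∘ Sum.inl) (x ∘ Sum.inr) := fun x =>
    (Sum.elim_comp_inl_inr x).symm
  obtain ⟨hl0, hl1, hl⟩ := scalar_root a h0
  set l := (2 + a ^ 2 - a * Real.sqrt (a ^ 2 + 4)) / 2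
  have hlow : ∀ x : Fin K ⊕ Fin K → ℝ, c₁ * l * (x ⬝ᵥ x) ≤ x ⬝ᵥ SigmaBlock A Se *ᵥ x := by
    intro x
    rw [hsplit x, hi, sumElim_dotProduct_sumElim]
    generalize x ∘ Sum.inl = x₁
    generalize x ∘ Sum.inr = x₂
    have e := mul_le_mul_of_nonneg_left
      (lower_vec a l (x₁ ⬝ᵥ x₁) (Aᵀ *ᵥ x₁) x₂ hl0 hl1 hl (hAt x₁)) hc₁.le
    have := hSlo x₁
    have := hGlo (Aᵀ *ᵥ x₁ + x₂)
    linarith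
  have hpos : ∀ x : Fin K ⊕ Fin K → ℝ, 0 ≤ x ⬝ᵥ SigmaBlock A Se *ᵥ x := fun x =>
    (mul_nonneg (mul_pos hc₁ hl0).le (dot_self_nn x)).trans (hlow x)
  refine ⟨hi, ?_, ?_, ?_⟩
  · refine Matrix.PosDef.of_dotProduct_mulVec_pos ?_ fun x hx => ?_
    · rw [Matrix.IsHermitian, Matrix.conjTranspose_eq_transpose_of_trivial, hSigt]
    · rw [star_trivial]
      refine lt_of_lt_of_le (mul_pos (mul_pos hc₁ hl0) ?_) (hlow x)
      exact lt_of_le_of_ne (dot_self_nn x) fun h => hx (dotProduct_self_eq_zero.1 h.symm)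
  · refine opNorm_quad _ _ (by positivity) hSigt hpos fun x => ?_
    rw [hsplit x, hexp, sumElim_dotProduct_sumElim]
    generalize x ∘ Sum.inl = x₁
    generalize x ∘ Sum.inr = x₂
    have e := hG0 (Aᵀ *ᵥ x₁ - x₂)
    simp only [mulVec_sub, dotProduct_sub, sub_dotProduct] at e
    rw [dot_symm _ hGt x₂ (Aᵀ *ᵥ x₁)] at e
    have e1 := hfixq x₁
    have e2 := hS0 x₁
    have e3 := hGhi x₁
    have e4 := hGhi x₂
    have g0 : 0 < c₂ / (1 - a ^ 2) := by positivity
    rw [mul_div_assoc]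
    have e5 := mul_nonneg g0.le (dot_self_nn x₁)
    have e6 := mul_nonneg g0.le (dot_self_nn x₂)
    linarith
  · intro h i
    have e := hlow (h.eigenvectorBasis i)
    rw [h.mulVec_eigenvectorBasis, dotProduct_smul, dot_self_eq] at e
    have hn : ‖h.eigenvectorBasis i‖ = 1 := h.eigenvectorBasis.orthonormal.1 i
    simpa [hn] using e
end

section
/- Let p ≥ 1, let S ⊆ {1,…,p} be nonempty with cardinality s, and let L > 0. For a real symmetric p×p matrix M define the squared compatibility constant φ²(L, S, M) := inf{ s · bᵀ M b / (∑_{j∈S} |b_j|)² : b ∈ ℝ^p, ∑_{j∉S} |b_j| ≤ L ∑_{j∈S} |b_j|, and b_j ≠ 0 for some j ∈ S }. Then: (i) if Σ is a real symmetric p×p matrix whose smallest eigenvalue is at least σ_min ≥ 0, then φ²(L, S, Σ) ≥ σ_min; and (ii) if in addition Σ̂ is a real symmetric p×p matrix with Δ := |Σ̂ − Σ|_∞ satisfying √σ_min > (L+1)√(sΔ), then φ²(L, S, Σ̂) ≥ (√σ_min − (L+1)√(sΔ))². -/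
open Matrix

/-- The squared compatibility constant `φ²(L, S, M)`. -/
noncomputable def phiSq {p : ℕ} (L : ℝ) (S : Finset (Fin p))
    (M : Matrix (Fin p) (Fin p) ℝ) : ℝ :=
  sInf {r : ℝ | ∃ b : Fin p → ℝ,
    (∑ j ∈ Sᶜ, |b j|) ≤ L * ∑ j ∈ S, |b j| ∧ (∃ j ∈ S, b j ≠ 0) ∧
    r = (S.card : ℝ) * (b ⬝ᵥ M *ᵥ b) / (∑ j ∈ S, |b j|) ^ 2}

lemma aux_eig {p : ℕ} (A : Matrix (Fin p) (Fin p) ℝ) (hA : A.IsHermitian) (σ : ℝ)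
    (hev : ∀ i : Fin p, σ ≤ hA.eigenvalues i) (b : Fin p → ℝ) :
    σ * ∑ i, b i ^ 2 ≤ b ⬝ᵥ A *ᵥ b := by
  have hH : (A - algebraMap ℝ (Matrix (Fin p) (Fin p) ℝ) σ).IsHermitian := by
    apply hA.sub
    rw [Matrix.algebraMap_eq_diagonal]
    exact Matrix.isHermitian_diagonal _
  have hP : (A - algebraMap ℝ (Matrix (Fin p) (Fin p) ℝ) σ).PosSemidef := by
    rw [hH.posSemidef_iff_eigenvalues_nonneg]
    intro i
    have h := hH.eigenvalues_mem_spectrum_real i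
    rw [← spectrum.sub_singleton_eq, hA.spectrum_real_eq_range_eigenvalues] at h
    obtain ⟨x, ⟨j, rfl⟩, y, hy, hxy⟩ := h
    rw [Set.mem_singleton_iff] at hy
    have := hev j
    simp only [Pi.zero_apply]
    rw [← hxy, hy]
    simpa using this
  have h := hP.dotProduct_mulVec_nonneg b
  rw [Matrix.sub_mulVec, dotProduct_sub, Matrix.algebraMap_eq_diagonal] at h
  have e : b ⬝ᵥ (diagonal (algebraMap ℝ (Fin p → ℝ) σ)) *ᵥ b = σ * ∑ i, b i ^ 2 := by
    simp only [dotProduct, Matrix.mulVec_diagonal, Finset.mul_sum]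
    refine Finset.sum_congr rfl fun i _ => ?_
    simp
    ring
  simp only [star_trivial] at h
  linarith

lemma aux_inf {p : ℕ} (L : ℝ) (hL : 0 < L) (S : Finset (Fin p)) (hS : S.Nonempty)
    (M : Matrix (Fin p) (Fin p) ℝ) (c : ℝ)
    (h : ∀ b : Fin p → ℝ, (∑ j ∈ Sᶜ, |b j|) ≤ L * ∑ j ∈ S, |b j| →
      c * (∑ j ∈ S, |b j|) ^ 2 ≤ (S.card : ℝ) * (b ⬝ᵥ M *ᵥ b)) : c ≤ phiSq L S M := by
  unfold phiSq
  apply le_csInf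
  · obtain ⟨k, hk⟩ := hS
    refine ⟨_, fun j => if j ∈ S then 1 else 0, ?_, ⟨k, hk, by simp [hk]⟩, rfl⟩
    have : (∑ j ∈ Sᶜ, |(if j ∈ S then (1:ℝ) else 0)|) = 0 := by
      refine Finset.sum_eq_zero fun j hj => ?_
      rw [Finset.mem_compl] at hj
      simp [hj]
    rw [this]
    positivity
  · rintro r ⟨b, hb, ⟨k, hk, hbk⟩, rfl⟩
    have hpos : 0 < ∑ j ∈ S, |b j| :=
      Finset.sum_pos' (fun _ _ => abs_nonneg _) ⟨k, hk, abs_pos.2 hbk⟩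
    rw [le_div_iff₀ (by positivity)]
    exact h b hb

lemma aux_low {p : ℕ} (S : Finset (Fin p)) (A : Matrix (Fin p) (Fin p) ℝ) (hA : A.IsHermitian)
    (σ : ℝ) (hσ : 0 ≤ σ) (hev : ∀ i : Fin p, σ ≤ hA.eigenvalues i) (b : Fin p → ℝ) :
    σ * (∑ j ∈ S, |b j|) ^ 2 ≤ (S.card : ℝ) * (b ⬝ᵥ A *ᵥ b) := by
  have h1 : (∑ j ∈ S, |b j|) ^ 2 ≤ (S.card : ℝ) * ∑ j ∈ S, |b j| ^ 2 := sq_sum_le_card_mul_sum_sq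
  have h2 : ∑ j ∈ S, |b j| ^ 2 ≤ ∑ j, b j ^ 2 := by
    simp only [sq_abs]
    exact Finset.sum_le_sum_of_subset_of_nonneg (Finset.subset_univ _) fun _ _ _ => sq_nonneg _
  have h3 := aux_eig A hA σ hev b
  have hc : (0:ℝ) ≤ S.card := Nat.cast_nonneg _
  calc σ * (∑ j ∈ S, |b j|) ^ 2 ≤ σ * ((S.card : ℝ) * ∑ j, b j ^ 2) := by gcongr; exact h1.trans (by gcongr)
    _ = (S.card : ℝ) * (σ * ∑ j, b j ^ 2) := by ring
    _ ≤ _ := by gcongr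

lemma aux_diff {p : ℕ} (A B : Matrix (Fin p) (Fin p) ℝ) (D : ℝ)
    (hD : ∀ i j, |B i j - A i j| ≤ D) (b : Fin p → ℝ) :
    b ⬝ᵥ A *ᵥ b - D * (∑ j, |b j|) ^ 2 ≤ b ⬝ᵥ B *ᵥ b := by
  have : b ⬝ᵥ A *ᵥ b - b ⬝ᵥ B *ᵥ b ≤ D * (∑ j, |b j|) ^ 2 := by
    rw [sq, Finset.sum_mul_sum, Finset.mul_sum]
    simp only [dotProduct, mulVec, Finset.mul_sum, ← Finset.sum_sub_distrib]
    refine Finset.sum_le_sum fun i _ => Finset.sum_le_sum fun j _ => ?_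
    calc b i * (A i j * b j) - b i * (B i j * b j) = -((B i j - A i j) * (b i * b j)) := by ring
      _ ≤ |(B i j - A i j) * (b i * b j)| := neg_le_abs _
      _ = |B i j - A i j| * (|b i| * |b j|) := by rw [abs_mul, abs_mul]
      _ ≤ _ := by gcongr; exact hD i j
  linarith

/-- (i) If the smallest eigenvalue of a symmetric matrix `Σ` is at least
`σ_min ≥ 0`, then `φ²(L, S, Σ) ≥ σ_min`. (ii) If moreover `Σ̂` is symmetric with
`Δ = |Σ̂ - Σ|_∞` satisfying `√σ_min > (L+1)√(sΔ)`, then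
`φ²(L, S, Σ̂) ≥ (√σ_min - (L+1)√(sΔ))²`. -/
theorem stmt8 (p : ℕ) (hp : 1 ≤ p) (S : Finset (Fin p)) (hS : S.Nonempty)
    (L : ℝ) (hL : 0 < L)
    (Sig SigHat : Matrix (Fin p) (Fin p) ℝ)
    (hSig : Sig.IsHermitian) (hSigHat : SigHat.IsHermitian)
    (σmin : ℝ) (hσ : 0 ≤ σmin)
    (hev : ∀ i : Fin p, σmin ≤ hSig.eigenvalues i) :
    σmin ≤ phiSq L S Sig ∧
      ((L + 1) * Real.sqrt ((S.card : ℝ) * (⨆ i : Fin p, ⨆ j : Fin p, |SigHat i j - Sig i j|))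
          < Real.sqrt σmin →
        (Real.sqrt σmin -
            (L + 1) *
              Real.sqrt
                ((S.card : ℝ) * (⨆ i : Fin p, ⨆ j : Fin p, |SigHat i j - Sig i j|))) ^ 2 ≤
          phiSq L S SigHat) := by
  refine ⟨aux_inf L hL S hS Sig σmin fun b _ => aux_low S Sig hSig σmin hσ hev b, ?_⟩
  have hD : ∀ i j, |SigHat i j - Sig i j| ≤ ⨆ i : Fin p, ⨆ j : Fin p, |SigHat i j - Sig i j| :=
    fun i j => (le_ciSup (f := fun j => |SigHat i j - Sig i j|) (Set.finite_range _).bddAbove j).trans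
      (le_ciSup (f := fun i => ⨆ j : Fin p, |SigHat i j - Sig i j|) (Set.finite_range _).bddAbove i)
  generalize (⨆ i : Fin p, ⨆ j : Fin p, |SigHat i j - Sig i j|) = D at hD ⊢
  intro hlt
  have hD0 : 0 ≤ D := (abs_nonneg _).trans (hD ⟨0, hp⟩ ⟨0, hp⟩)
  have hc : (0:ℝ) ≤ S.card := Nat.cast_nonneg _
  apply aux_inf L hL S hS
  intro b hb
  have h1 := aux_low S Sig hSig σmin hσ hev b
  have h2 := aux_diff Sig SigHat D hD b
  have h3 : ∑ j, |b j| ≤ (L + 1) * ∑ j ∈ S, |b j| := by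
    rw [← Finset.sum_add_sum_compl S]; linarith
  have h0 : 0 ≤ ∑ j, |b j| := Finset.sum_nonneg fun _ _ => abs_nonneg _
  have h4 : (∑ j, |b j|) ^ 2 ≤ ((L + 1) * ∑ j ∈ S, |b j|) ^ 2 := by gcongr
  have hx := Real.sq_sqrt hσ
  have hy := Real.sq_sqrt (mul_nonneg hc hD0)
  have hy0 := Real.sqrt_nonneg ((S.card : ℝ) * D)
  have hcD := mul_nonneg hc hD0
  generalize Real.sqrt σmin = x at *
  generalize Real.sqrt ((S.card : ℝ) * D) = y at *
  generalize (∑ j ∈ S, |b j|) = T at *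
  have h5 : (x - (L + 1) * y) ^ 2 ≤ σmin - (L + 1) ^ 2 * (S.card * D) := by
    rw [← hx, ← hy]
    have : 0 ≤ (L + 1) * y := by positivity
    nlinarith
  have h6 := mul_le_mul_of_nonneg_left h2 hc
  have h7 := mul_le_mul_of_nonneg_left h4 hcD
  have h8 := mul_le_mul_of_nonneg_right h5 (sq_nonneg T)
  linarith
end

section
/- Let X be a real-valued random variable on a probability space with cumulative distribution function F(x) := P(X ≤ x) and left limit F(x−) := P(X < x). Let V be a random variable uniformly distributed on [0,1] and independent of X. Define Ũ := (1 − V)·F(X−) + V·F(X). Then Ũ is uniformly distributed on [0,1], and moreover X = F⁻¹(Ũ) almost surely, where F⁻¹(u) := inf{x ∈ ℝ : F(x) ≥ u} is the quantile function of X. -/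
open MeasureTheory ProbabilityTheory

lemma aux_null (ν : Measure ℝ) (q : ℝ) : ν {y | q < y ∧ ν (Set.Ioc q y) = 0} = 0 := by
  by_cases h : ∃ m, (q < m ∧ ν (Set.Ioc q m) = 0) ∧ ∀ y, (q < y ∧ ν (Set.Ioc q y) = 0) → y ≤ m
  · obtain ⟨m, hm, hmax⟩ := h
    exact measure_mono_null (t := Set.Ioc q m) (fun y hy => ⟨hy.1, hmax y hy⟩) hm.2
  · push Not at h
    refine measure_mono_null (t := ⋃ r : ℚ, {y | y ∈ Set.Ioc q (r:ℝ) ∧ ν (Set.Ioc q (r:ℝ)) = 0}) ?_ ?_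
    · intro y hy
      obtain ⟨y', hy', hlt⟩ := h y hy
      obtain ⟨r, hr1, hr2⟩ := exists_rat_btwn hlt
      refine Set.mem_iUnion.2 ⟨r, ⟨hy.1, hr1.le⟩, ?_⟩
      exact measure_mono_null (Set.Ioc_subset_Ioc_right hr2.le) hy'.2
    · refine measure_iUnion_null fun r => ?_
      by_cases hr : ν (Set.Ioc q (r:ℝ)) = 0
      · exact measure_mono_null (fun y hy => hy.1) hr
      · simp [hr]

lemma aux_null2 (ν : Measure ℝ) : ν {y | ∃ x < y, ν (Set.Ioc x y) = 0} = 0 := by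
  refine measure_mono_null (t := ⋃ q : ℚ, {y | (q:ℝ) < y ∧ ν (Set.Ioc (q:ℝ) y) = 0}) ?_
    (measure_iUnion_null fun q => aux_null ν q)
  rintro y ⟨x, hx, h0⟩
  obtain ⟨r, hr1, hr2⟩ := exists_rat_btwn hx
  exact Set.mem_iUnion.2 ⟨r, hr2, measure_mono_null (Set.Ioc_subset_Ioc_left hr1.le) h0⟩

lemma aux_quant (ν : Measure ℝ) [IsProbabilityMeasure ν] (u : ℝ) (h0 : 0 < u) (h1 : u < 1) :
    ∃ x, ν.real (Set.Iio x) ≤ u ∧ u ≤ ν.real (Set.Iic x) := by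
  set S : Set ℝ := {x | u ≤ cdf ν x} with hS
  have hne : S.Nonempty := by
    obtain ⟨x, hx⟩ := ((tendsto_cdf_atTop ν).eventually (lt_mem_nhds h1)).exists
    exact ⟨x, hx.le⟩
  have hbd : BddBelow S := by
    obtain ⟨x, hx⟩ := ((tendsto_cdf_atBot ν).eventually (gt_mem_nhds h0)).exists
    refine ⟨x, fun y hy => ?_⟩
    by_contra hlt
    push Not at hlt
    have := monotone_cdf ν hlt.le
    have hy' : u ≤ cdf ν y := hy
    linarith
  refine ⟨sInf S, ?_, ?_⟩
  · have h := (cdf ν).measure_Iio (tendsto_cdf_atBot ν) (sInf S)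
    rw [measure_cdf] at h
    rw [Measure.real, h, ENNReal.toReal_ofReal', sub_zero]
    refine max_le ?_ h0.le
    refine le_of_tendsto ((monotone_cdf ν).tendsto_leftLim (sInf S)) ?_
    filter_upwards [self_mem_nhdsWithin] with y hy
    by_contra hlt
    push Not at hlt
    exact absurd (csInf_le hbd (show y ∈ S from hlt.le)) (not_le.2 hy)
  · rw [← cdf_eq_real]
    have hc : Filter.Tendsto (cdf ν) (nhdsWithin (sInf S) (Set.Ioi (sInf S))) (nhds (cdf ν (sInf S))) :=
      ((cdf ν).right_continuous (sInf S)).mono_left (nhdsWithin_mono _ Set.Ioi_subset_Ici_self)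
    refine ge_of_tendsto hc ?_
    filter_upwards [self_mem_nhdsWithin] with y hy
    obtain ⟨z, hz, hzy⟩ := exists_lt_of_csInf_lt hne hy
    exact le_trans hz (monotone_cdf ν hzy.le)

lemma aux_main {Ω : Type*} [MeasurableSpace Ω] (μ : Measure Ω) [IsProbabilityMeasure μ]
    (X V : Ω → ℝ) (hX : Measurable X) (hV : Measurable V)
    (hVunif : μ.map V = volume.restrict (Set.Icc (0 : ℝ) 1))
    (hindep : IndepFun X V μ) (F G : ℝ → ℝ)
    (hF : ∀ x, F x = μ.real (X ⁻¹' Set.Iic x)) (hG : ∀ x, G x = μ.real (X ⁻¹' Set.Iio x))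
    (hFG : ∀ x y, x < y → F x ≤ G y) (hGF : ∀ x, G x ≤ F x)
    (hV01 : ∀ᵐ ω ∂μ, 0 < V ω ∧ V ω ≤ 1)
    (u : ℝ) (h0 : 0 < u) (h1 : u < 1) :
    μ.real {ω | (1 - V ω) * G (X ω) + V ω * F (X ω) < u} ≤ u ∧
    u ≤ μ.real {ω | (1 - V ω) * G (X ω) + V ω * F (X ω) ≤ u} := by
  have : IsProbabilityMeasure (μ.map X) := Measure.isProbabilityMeasure_map hX.aemeasurable
  obtain ⟨x, hx1, hx2⟩ := aux_quant (μ.map X) u h0 h1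
  rw [map_measureReal_apply hX measurableSet_Iio, ← hG] at hx1
  rw [map_measureReal_apply hX measurableSet_Iic, ← hF] at hx2
  have hU1 : ∀ᵐ ω ∂μ, (1 - V ω) * G (X ω) + V ω * F (X ω) < u → X ω ≤ x := by
    filter_upwards [hV01] with ω hω h
    by_contra hlt
    push Not at hlt
    nlinarith [hFG _ _ hlt, hGF (X ω)]
  have hU2 : ∀ᵐ ω ∂μ, X ω < x → (1 - V ω) * G (X ω) + V ω * F (X ω) ≤ u := by
    filter_upwards [hV01] with ω hω h
    nlinarith [hFG _ _ h, hGF (X ω)]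
  have hp : F x = G x + μ.real (X ⁻¹' {x}) := by
    rw [hF, hG, ← measureReal_union _ (hX (measurableSet_singleton x)), ← Set.preimage_union]
    · congr 2; ext y; simp [le_iff_lt_or_eq]
    · refine Disjoint.preimage _ ?_
      simp
  rcases (hGF x).eq_or_lt with he | hlt
  · have hu : u = F x := by linarith
    constructor
    · rw [hu, hF x]
      refine ENNReal.toReal_mono (measure_ne_top _ _) (measure_mono_ae ?_)
      filter_upwards [hU1] with ω hω h
      rw [← hF x, ← hu] at h
      exact hω h
    · conv_lhs => rw [hu, ← he, hG]
      refine ENNReal.toReal_mono (measure_ne_top _ _) (measure_mono_ae ?_)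
      filter_upwards [hU2] with ω hω h
      exact hω h
  · set p := F x - G x with hpdef
    have hppos : 0 < p := by simp only [hpdef]; linarith
    set t := (u - G x) / p with ht
    have ht0 : 0 ≤ t := div_nonneg (by linarith) hppos.le
    have ht1 : t ≤ 1 := by rw [ht, div_le_one hppos]; simp only [hpdef]; linarith
    have htp : p * t = u - G x := by rw [ht]; field_simp
    have hind : ∀ S : Set ℝ, MeasurableSet S → 
        μ.real (X ⁻¹' Set.Iio x ∪ (X ⁻¹' {x} ∩ V ⁻¹' S)) = G x + p * (volume.restrict (Set.Icc (0 : ℝ) 1)).real S := by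
      intro S hS
      rw [measureReal_union _ ((hX (measurableSet_singleton x)).inter (hV hS)), ← hG, ← hVunif,
        map_measureReal_apply hV hS]
      · congr 1
        have := hindep.measure_inter_preimage_eq_mul {x} S (measurableSet_singleton x) hS
        rw [Measure.real, this, ENNReal.toReal_mul]
        congr 1
        change μ.real _ = _
        linarith
      · refine Disjoint.mono_right Set.inter_subset_left (Disjoint.preimage _ ?_)
        simp
    have hm : (volume.restrict (Set.Icc (0 : ℝ) 1)).real (Set.Iic t) = t := by
      rw [measureReal_restrict_apply measurableSet_Iic]
      have : Set.Iic t ∩ Set.Icc (0:ℝ) 1 = Set.Icc 0 t := by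
        ext y; simp only [Set.mem_inter_iff, Set.mem_Iic, Set.mem_Icc]
        constructor
        · rintro ⟨a, b, c⟩; exact ⟨b, a⟩
        · rintro ⟨a, b⟩; exact ⟨b, a, b.trans ht1⟩
      rw [this, Real.volume_real_Icc]
      simpa using ht0
    have key := hind (Set.Iic t) measurableSet_Iic
    rw [hm, htp, add_sub_cancel] at key
    constructor
    · conv_rhs => rw [← key]
      refine ENNReal.toReal_mono (measure_ne_top _ _) (measure_mono_ae ?_)
      filter_upwards [hU1] with ω hω h
      rcases (hω h).lt_or_eq with h' | h'
      · exact Or.inl h'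
      · refine Or.inr ⟨h', ?_⟩
        have h2 : (1 - V ω) * G (X ω) + V ω * F (X ω) < u := h
        rw [h'] at h2
        change V ω ≤ t
        rw [ht, le_div_iff₀ hppos]
        simp only [hpdef]; linarith
    · conv_lhs => rw [← key]
      refine ENNReal.toReal_mono (measure_ne_top _ _) (measure_mono_ae ?_)
      filter_upwards [hU2] with ω hω h
      rcases h with h | ⟨h, h3⟩
      · exact hω h
      · change (1 - V ω) * G (X ω) + V ω * F (X ω) ≤ u
        have h4 : X ω = x := h
        have h5 : V ω ≤ t := h3
        rw [ht, le_div_iff₀ hppos] at h5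
        rw [h4]
        simp only [hpdef] at h5; linarith

/-- Distributional transform: if `V` is uniform on `[0,1]` and independent
of `X`, then `Ũ = (1-V)·F(X−) + V·F(X)` is uniform on `[0,1]` and `X = F⁻¹(Ũ)` a.s., where
`F⁻¹(u) = inf {x : F(x) ≥ u}` is the quantile function. -/
theorem stmt11 {Ω : Type*} [MeasurableSpace Ω] (μ : Measure Ω) [IsProbabilityMeasure μ]
    (X V : Ω → ℝ) (hX : Measurable X) (hV : Measurable V)
    (hVunif : μ.map V = volume.restrict (Set.Icc (0 : ℝ) 1))
    (hindep : IndepFun X V μ) :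
    μ.map (fun ω =>
        (1 - V ω) * (μ (X ⁻¹' Set.Iio (X ω))).toReal +
          V ω * (μ (X ⁻¹' Set.Iic (X ω))).toReal) =
      volume.restrict (Set.Icc (0 : ℝ) 1) ∧
      (∀ᵐ ω ∂μ, X ω =
        sInf {x : ℝ |
          (1 - V ω) * (μ (X ⁻¹' Set.Iio (X ω))).toReal +
              V ω * (μ (X ⁻¹' Set.Iic (X ω))).toReal ≤
            (μ (X ⁻¹' Set.Iic x)).toReal}) := by
  obtain ⟨F, hF⟩ : ∃ F : ℝ → ℝ, ∀ x, F x = (μ (X ⁻¹' Set.Iic x)).toReal := ⟨_, fun _ => rfl⟩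
  obtain ⟨G, hG⟩ : ∃ G : ℝ → ℝ, ∀ x, G x = (μ (X ⁻¹' Set.Iio x)).toReal := ⟨_, fun _ => rfl⟩
  simp only [← hF, ← hG]
  have hmF : Monotone F := fun x y h => by
    rw [hF, hF]
    exact ENNReal.toReal_mono (measure_ne_top _ _) (measure_mono (Set.preimage_mono (Set.Iic_subset_Iic.2 h)))
  have hmG : Monotone G := fun x y h => by
    rw [hG, hG]
    exact ENNReal.toReal_mono (measure_ne_top _ _) (measure_mono (Set.preimage_mono (Set.Iio_subset_Iio h)))
  have hFG : ∀ x y, x < y → F x ≤ G y := fun x y h => by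
    rw [hF, hG]
    exact ENNReal.toReal_mono (measure_ne_top _ _) (measure_mono (Set.preimage_mono (Set.Iic_subset_Iio.2 h)))
  have hGF : ∀ x, G x ≤ F x := fun x => by
    rw [hF, hG]
    exact ENNReal.toReal_mono (measure_ne_top _ _) (measure_mono (Set.preimage_mono Set.Iio_subset_Iic_self))
  have hV01 : ∀ᵐ ω ∂μ, 0 < V ω ∧ V ω ≤ 1 := by
    have : ∀ᵐ v ∂(μ.map V), 0 < v ∧ v ≤ 1 := by
      rw [hVunif, ← restrict_Ioc_eq_restrict_Icc]
      filter_upwards [ae_restrict_mem measurableSet_Ioc] with v hv using hv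
    exact ae_of_ae_map hV.aemeasurable this
  constructor
  · have main := aux_main μ X V hX hV hVunif hindep F G hF hG hFG hGF hV01
    have hmeas : Measurable (fun ω => (1 - V ω) * G (X ω) + V ω * F (X ω)) := by
      have := hmF.measurable
      have := hmG.measurable
      fun_prop
    generalize hU : (fun ω => (1 - V ω) * G (X ω) + V ω * F (X ω)) = U at hmeas ⊢
    have main' : ∀ u, 0 < u → u < 1 → μ.real {ω | U ω < u} ≤ u ∧ u ≤ μ.real {ω | U ω ≤ u} := by
      subst hU; exact main
    have hmono : ∀ a b, a < b → μ.real {ω | U ω ≤ a} ≤ μ.real {ω | U ω < b} := fun a b h =>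
      measureReal_mono (fun ω (hω : U ω ≤ a) => lt_of_le_of_lt hω h)
    have hmono2 : ∀ a b, a ≤ b → μ.real {ω | U ω ≤ a} ≤ μ.real {ω | U ω ≤ b} := fun a b h =>
      measureReal_mono (fun ω (hω : U ω ≤ a) => le_trans hω h)
    have : IsProbabilityMeasure (μ.map U) := Measure.isProbabilityMeasure_map hmeas.aemeasurable
    refine Measure.ext_of_Iic _ _ fun u => ?_
    rw [← measureReal_eq_measureReal_iff, map_measureReal_apply hmeas measurableSet_Iic,
      measureReal_restrict_apply measurableSet_Iic]
    have h2 : Set.Iic u ∩ Set.Icc (0:ℝ) 1 = Set.Icc 0 (min u 1) := by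
      ext y; simp only [Set.mem_inter_iff, Set.mem_Iic, Set.mem_Icc, le_min_iff]; tauto
    rw [h2, Real.volume_real_Icc, sub_zero]
    change μ.real {ω | U ω ≤ u} = _
    apply le_antisymm
    · by_cases h1 : u < 1
      · refine le_of_forall_gt_imp_ge_of_dense fun a ha => ?_
        rw [min_eq_left h1.le, max_lt_iff] at ha
        by_cases ha1 : a < 1
        · exact (hmono u a ha.1).trans (main' a ha.2 ha1).1
        · exact measureReal_le_one.trans (not_lt.1 ha1)
      · rw [min_eq_right (not_lt.1 h1)]
        exact measureReal_le_one.trans (le_max_left _ _)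
    · refine max_le ?_ measureReal_nonneg
      refine le_of_forall_lt_imp_le_of_dense fun a ha => ?_
      rw [lt_min_iff] at ha
      by_cases ha0 : 0 < a
      · exact (main' a ha0 ha.2).2.trans (hmono2 _ _ ha.1.le)
      · exact (not_lt.1 ha0).trans measureReal_nonneg
  · have hB : ∀ᵐ ω ∂μ, ¬ ∃ x < X ω, (μ.map X) (Set.Ioc x (X ω)) = 0 := by
      refine ae_of_ae_map (p := fun y => ¬ ∃ x < y, (μ.map X) (Set.Ioc x y) = 0) hX.aemeasurable ?_
      rw [ae_iff]
      simpa only [not_not] using aux_null2 (μ.map X)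
    filter_upwards [hV01, hB] with ω hω hb
    refine (IsLeast.csInf_eq ⟨?_, ?_⟩).symm
    · rw [Set.mem_ofPred_eq]
      nlinarith [hGF (X ω)]
    · intro x hx
      rw [Set.mem_ofPred_eq] at hx
      by_contra hlt
      push Not at hlt
      refine hb ⟨x, hlt, ?_⟩
      have h1 := hFG _ _ hlt
      have h3 := hGF (X ω)
      have h2 : F (X ω) ≤ F x := by
        have : V ω * (F (X ω) - G (X ω)) ≤ 0 := by nlinarith
        have : F (X ω) - G (X ω) ≤ 0 := by
          by_contra hc
          push Not at hc
          have := mul_pos hω.1 hc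
          linarith
        nlinarith
      rw [Measure.map_apply hX measurableSet_Ioc, show Set.Ioc x (X ω) = Set.Iic (X ω) \ Set.Iic x by ext; simp [and_comm], Set.preimage_diff,
        measure_diff (Set.preimage_mono (Set.Iic_subset_Iic.2 hlt.le))
          (hX measurableSet_Iic).nullMeasurableSet (measure_ne_top _ _), tsub_eq_zero_iff_le]
      rw [hF, hF] at h2
      exact (ENNReal.toReal_le_toReal (measure_ne_top _ _) (measure_ne_top _ _)).1 h2
end

section
/- Let Z and W be independent standard normal random variables and let r ∈ [−1,1]. Set Z₂ := r·Z + √(1−r²)·W, so that (Z, Z₂) is a bivariate standard normal pair with correlation r. Let Φ denote the standard normal cumulative distribution function. Then Cov(Φ(Z), Φ(Z₂)) = (1/(2π))·arcsin(r/2). Equivalently, writing ρ := 12·Cov(Φ(Z), Φ(Z₂)) for the population Spearman rho of the pair, one has r = 2·sin(πρ/6). -/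
open MeasureTheory ProbabilityTheory

/-- The standard normal cumulative distribution function `Φ`. -/
noncomputable def stdPhi (t : ℝ) : ℝ :=
  (gaussianReal 0 1 (Set.Iic t)).toReal

/-- The covariance `Cov(Φ(Z), Φ(Z₂))`. -/
noncomputable def covPhi {Ω : Type*} [MeasurableSpace Ω] (μ : Measure Ω)
    (Z Z₂ : Ω → ℝ) : ℝ :=
  (∫ ω, stdPhi (Z ω) * stdPhi (Z₂ ω) ∂μ) -
    (∫ ω, stdPhi (Z ω) ∂μ) * ∫ ω, stdPhi (Z₂ ω) ∂μ

open Filter Topology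

local notation "γ" => gaussianReal 0 1
local notation "ph" => gaussianPDFReal 0 1

lemma ph_eq (x : ℝ) : ph x = (√(2 * Real.pi))⁻¹ * Real.exp (-(1/2) * x ^ 2) := by
  simp only [gaussianPDFReal_def, NNReal.coe_one, mul_one, sub_zero]
  congr 2; ring

lemma ph_cont : Continuous ph := by
  have : (ph : ℝ → ℝ) = fun x => (√(2 * Real.pi))⁻¹ * Real.exp (-(1/2) * x ^ 2) := funext ph_eq
  rw [this]; fun_prop

lemma ph_le (x : ℝ) : ph x ≤ 1 := by
  rw [ph_eq]
  have h1 : 1 ≤ √(2 * Real.pi) := by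
    rw [Real.one_le_sqrt]; linarith [Real.pi_gt_three]
  have h2 : (√(2 * Real.pi))⁻¹ ≤ 1 := inv_le_one_of_one_le₀ h1
  have h3 : Real.exp (-(1/2) * x ^ 2) ≤ 1 := by
    rw [Real.exp_le_one_iff]; nlinarith [sq_nonneg x]
  exact mul_le_one₀ h2 (Real.exp_pos _).le h3

lemma stdPhi_nonneg (t : ℝ) : 0 ≤ stdPhi t := ENNReal.toReal_nonneg

lemma stdPhi_le (t : ℝ) : stdPhi t ≤ 1 := by
  unfold stdPhi
  exact ENNReal.toReal_le_of_le_ofReal zero_le_one (by simpa using prob_le_one)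

lemma stdPhi_eq (t : ℝ) : stdPhi t = ∫ x in Set.Iic t, ph x := by
  unfold stdPhi
  rw [gaussianReal_apply_eq_integral _ one_ne_zero, ENNReal.toReal_ofReal]
  exact integral_nonneg fun x => gaussianPDFReal_nonneg _ _ _

lemma stdPhi_deriv (t : ℝ) : HasDerivAt stdPhi (ph t) t := by
  have h : stdPhi = fun t => stdPhi 0 + ∫ x in (0:ℝ)..t, ph x := by
    funext t
    have hi := integrable_gaussianPDFReal 0 1
    rw [stdPhi_eq, stdPhi_eq, ← intervalIntegral.integral_Iic_sub_Iic hi.integrableOn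
      hi.integrableOn]
    ring
  rw [h]
  exact ((ph_cont.integral_hasStrictDerivAt 0 t).hasDerivAt).const_add _

lemma stdPhi_cont : Continuous stdPhi :=
  continuous_iff_continuousAt.2 fun t => (stdPhi_deriv t).continuousAt

lemma stdPhi_norm (t : ℝ) : ‖stdPhi t‖ ≤ 1 := by
  rw [Real.norm_eq_abs, abs_of_nonneg (stdPhi_nonneg t)]; exact stdPhi_le t

lemma stdPhi_neg (t : ℝ) : stdPhi (-t) = 1 - stdPhi t := by
  have h := integral_gaussianPDFReal_eq_one 0 (one_ne_zero (α := NNReal))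
  have hi := integrable_gaussianPDFReal 0 1
  rw [← intervalIntegral.integral_Iic_add_Ioi (b := t) hi.integrableOn hi.integrableOn,
    ← stdPhi_eq] at h
  have h2 := integral_comp_neg_Iic (-t) (fun x => ph x)
  rw [neg_neg] at h2
  rw [stdPhi_eq (-t), ← h, ← h2]
  have : ∀ x, ph (-x) = ph x := fun x => by simp [ph_eq]
  simp [this]

lemma int_stdPhi_mul (k : ℝ) : ∫ z, stdPhi (k * z) ∂γ = 1 / 2 := by
  have h : ∫ z, stdPhi (k * z) ∂γ = ∫ z, stdPhi (k * -z) ∂γ := by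
    have h1 : (γ).map (fun x => -x) = γ := by
      rw [gaussianReal_map_neg]; simp
    conv_lhs => rw [← h1]
    rw [integral_map (by fun_prop)]
    exact (stdPhi_cont.comp (by fun_prop)).aestronglyMeasurable
  have hi : Integrable (fun z => stdPhi (k * z)) γ :=
    Integrable.of_bound (stdPhi_cont.comp (by fun_prop)).aestronglyMeasurable 1
      (ae_of_all _ fun z => stdPhi_norm _)
  have h2 : ∫ z, stdPhi (k * -z) ∂γ = 1 - ∫ z, stdPhi (k * z) ∂γ := by
    simp_rw [mul_neg, stdPhi_neg]
    rw [integral_sub (integrable_const _) hi]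
    simp
  linarith

lemma stdPhi_conv (a s : ℝ) : ∫ w, stdPhi (a + s * w) ∂γ = stdPhi (a / √(1 + s ^ 2)) := by
  have hc : 0 < √(1 + s ^ 2) := Real.sqrt_pos.2 (by positivity)
  set c := √(1 + s ^ 2) with hcdef
  have hc2 : c ^ 2 = 1 + s ^ 2 := Real.sq_sqrt (by positivity)
  have hR : γ (Set.Iic (a / c)) = gaussianReal 0 (.mk (c ^ 2) (sq_nonneg _)) (Set.Iic a) := by
    have := gaussianReal_map_const_mul (μ := 0) (v := 1) c
    rw [mul_zero, mul_one] at this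
    rw [← this, Measure.map_apply (by fun_prop) measurableSet_Iic]
    congr 1; ext x
    simp [le_div_iff₀' hc]
  have hmap : ((γ).prod γ).map ((fun p : ℝ × ℝ => p.2) + fun p : ℝ × ℝ => (-s) * p.1)
      = gaussianReal 0 (.mk (c ^ 2) (sq_nonneg _)) := by
    have h1 : ((γ).prod γ).map (fun p : ℝ × ℝ => p.2) = γ := by
      have := Measure.map_snd_prod (μ := γ) (ν := γ)
      simpa using this
    have h2 : ((γ).prod γ).map (fun p : ℝ × ℝ => (-s) * p.1)
        = gaussianReal 0 (.mk ((-s) ^ 2) (sq_nonneg _)) := by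
      have h3 := Measure.map_fst_prod (μ := γ) (ν := γ)
      have h4 := gaussianReal_map_const_mul (μ := 0) (v := 1) (-s)
      rw [mul_zero, mul_one] at h4
      rw [← h4]
      conv_rhs => rw [show (γ) = ((γ).prod γ).map Prod.fst by simpa using h3.symm]
      rw [Measure.map_map (by fun_prop) (by fun_prop)]
      rfl
    have hind : IndepFun (fun p : ℝ × ℝ => p.2) (fun p : ℝ × ℝ => (-s) * p.1) ((γ).prod γ) :=
      (indepFun_prod (X := id) (Y := fun x : ℝ => x) (μ := γ) (ν := γ)
        measurable_id measurable_id).symm.comp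
          (φ := id) (ψ := fun x => (-s) * x) measurable_id (by fun_prop)
    rw [gaussianReal_add_gaussianReal_of_indepFun hind h1 h2]
    congr 1
    · simp
    · ext; simp [hc2]
  unfold stdPhi
  rw [integral_toReal, hR, ← hmap, Measure.map_apply (by fun_prop) measurableSet_Iic,
    Measure.prod_apply]
  · congr 1
    apply lintegral_congr
    intro w
    congr 1; ext y
    simp
  · exact (show Measurable _ by fun_prop) measurableSet_Iic
  · have hm : Monotone (fun t => γ (Set.Iic t)) := fun x y h =>
      measure_mono (Set.Iic_subset_Iic.2 h)
    exact (hm.measurable.comp (by fun_prop : Measurable fun w => a + s * w)).aemeasurable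
  · exact ae_of_all _ fun _ => measure_lt_top _ _

lemma int_deriv (k : ℝ) : ∫ z, stdPhi z * (z * ph (k * z)) ∂γ
    = (2 * Real.pi)⁻¹ * ((1 + k ^ 2)⁻¹ * (√(2 + k ^ 2))⁻¹) := by
  have hb : 0 < (1 + k ^ 2) / 2 := by positivity
  set b := (1 + k ^ 2) / 2 with hbdef
  have hpi : (√(2 * Real.pi))⁻¹ * (√(2 * Real.pi))⁻¹ = (2 * Real.pi)⁻¹ := by
    rw [← mul_inv, Real.mul_self_sqrt (by positivity)]
  rw [integral_gaussianReal_eq_integral_smul one_ne_zero]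
  have e1 : ∀ z, ph z • (stdPhi z * (z * ph (k * z)))
      = (2 * Real.pi)⁻¹ * (stdPhi z * (z * Real.exp (-b * z ^ 2))) := by
    intro z
    have : Real.exp (-b * z ^ 2) = Real.exp (-(1/2) * z ^ 2) * Real.exp (-(1/2) * (k * z) ^ 2) := by
      rw [← Real.exp_add, hbdef]; congr 1; ring
    rw [ph_eq, ph_eq, ← hpi, this, smul_eq_mul]; ring
  simp_rw [e1]
  rw [integral_const_mul]
  congr 1
  have hbdd : ∀ f : ℝ → ℝ, Integrable f → Integrable (fun z => stdPhi z * f z) := fun f hf =>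
    hf.bdd_mul (c := 1) stdPhi_cont.aestronglyMeasurable (ae_of_all _ stdPhi_norm)
  have hE := integrable_exp_neg_mul_sq hb
  have e2 : ∀ z, ph z * (-(2 * b)⁻¹ * Real.exp (-b * z ^ 2))
      = (-(2 * b)⁻¹ * (√(2 * Real.pi))⁻¹) * Real.exp (-(b + 1/2) * z ^ 2) := by
    intro z
    have : Real.exp (-(b + 1/2) * z ^ 2)
        = Real.exp (-(1/2) * z ^ 2) * Real.exp (-b * z ^ 2) := by
      rw [← Real.exp_add]; congr 1; ring
    rw [ph_eq, this]; ring
  have ibp := integral_mul_deriv_eq_deriv_mul_of_integrable (u := stdPhi) (u' := ph)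
    (v := fun z => -(2 * b)⁻¹ * Real.exp (-b * z ^ 2)) (v' := fun z => z * Real.exp (-b * z ^ 2))
    (fun x _ => stdPhi_deriv x)
    (fun x _ => by
      have h1 : HasDerivAt (fun z : ℝ => -b * z ^ 2) (-b * (2 * x)) x := by
        simpa using (hasDerivAt_pow 2 x).const_mul (-b)
      have := (h1.exp).const_mul (-(2 * b)⁻¹)
      convert this using 1
      field_simp)
    (hbdd _ (integrable_mul_exp_neg_mul_sq hb))
    (by
      have : Integrable (fun z => ph z * (-(2 * b)⁻¹ * Real.exp (-b * z ^ 2))) := by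
        simp_rw [e2]
        exact (integrable_exp_neg_mul_sq (by positivity)).const_mul _
      exact this)
    (hbdd _ (hE.const_mul _))
  rw [ibp]
  simp_rw [e2]
  rw [integral_const_mul, integral_gaussian]
  have h2b : 2 * b = 1 + k ^ 2 := by rw [hbdef]; ring
  have e3 : √(Real.pi / (b + 1/2)) = √(2 * Real.pi) * (√(2 + k ^ 2))⁻¹ := by
    rw [← Real.sqrt_inv, ← Real.sqrt_mul (by positivity)]
    congr 1
    rw [hbdef]; field_simp; ring
  have h2p : √(2 * Real.pi) ≠ 0 := (Real.sqrt_pos.2 (by positivity)).ne'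
  rw [e3, h2b]
  field_simp

lemma F_deriv (k : ℝ) : HasDerivAt (fun k => ∫ z, stdPhi z * stdPhi (k * z) ∂γ)
    ((2 * Real.pi)⁻¹ * ((1 + k ^ 2)⁻¹ * (√(2 + k ^ 2))⁻¹)) k := by
  rw [← int_deriv]
  have hm : ∀ k : ℝ, AEStronglyMeasurable (fun z => stdPhi z * stdPhi (k * z)) γ := fun k =>
    (stdPhi_cont.mul (stdPhi_cont.comp (by fun_prop))).aestronglyMeasurable
  refine (hasDerivAt_integral_of_dominated_loc_of_deriv_le (s := Set.univ)
    (F := fun k z => stdPhi z * stdPhi (k * z))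
    (F' := fun k z => stdPhi z * (z * ph (k * z))) (bound := fun z => ‖z‖)
    univ_mem (Eventually.of_forall hm) ?_ ?_ ?_ ?_ ?_).2
  · refine Integrable.of_bound (hm k) 1 (ae_of_all _ fun z => ?_)
    rw [norm_mul]
    exact mul_le_one₀ (stdPhi_norm _) (norm_nonneg _) (stdPhi_norm _)
  · exact (stdPhi_cont.mul (continuous_id.mul (ph_cont.comp (by fun_prop)))).aestronglyMeasurable
  · refine ae_of_all _ fun z x _ => ?_
    rw [norm_mul, norm_mul]
    have h1 : ‖ph (x * z)‖ ≤ 1 := by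
      rw [Real.norm_eq_abs, abs_of_nonneg (gaussianPDFReal_nonneg _ _ _)]; exact ph_le _
    have h2 : ‖z‖ * ‖ph (x * z)‖ ≤ ‖z‖ := mul_le_of_le_one_right (norm_nonneg _) h1
    exact (mul_le_of_le_one_left (by positivity) (stdPhi_norm _)).trans h2
  · exact ((memLp_id_gaussianReal 1).integrable (by simp)).norm
  · refine ae_of_all _ fun z x _ => ?_
    have h1 : HasDerivAt (fun x : ℝ => x * z) z x := by simpa using (hasDerivAt_id x).mul_const z
    have := ((stdPhi_deriv (x * z)).comp x h1).const_mul (stdPhi z)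
    exact this.congr_deriv (by ring)

lemma G_deriv (k : ℝ) : HasDerivAt (fun k => (2 * Real.pi)⁻¹ * Real.arctan (k / √(2 + k ^ 2)))
    ((2 * Real.pi)⁻¹ * ((1 + k ^ 2)⁻¹ * (√(2 + k ^ 2))⁻¹)) k := by
  have hp : 0 < 2 + k ^ 2 := by positivity
  have hq : 0 < √(2 + k ^ 2) := Real.sqrt_pos.2 hp
  have hs : √(2 + k ^ 2) ^ 2 = 2 + k ^ 2 := Real.sq_sqrt hp.le
  have h1 : HasDerivAt (fun k : ℝ => 2 + k ^ 2) (2 * k) k := by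
    simpa using (hasDerivAt_pow 2 k).const_add 2
  have h2 := h1.sqrt hp.ne'
  have h3 := (((hasDerivAt_id k).div h2 hq.ne').arctan).const_mul ((2 * Real.pi)⁻¹)
  refine h3.congr_deriv (Eq.symm ?_)
  congr 1
  simp only [id, Pi.div_apply]
  set q := √(2 + k ^ 2)
  have hk : k ^ 2 = q ^ 2 - 2 := by linarith
  have h5 : 1 + (k / q) ^ 2 ≠ 0 := by positivity
  have h6 : 1 + k ^ 2 ≠ 0 := by positivity
  have h7 : q ^ 2 + k ^ 2 ≠ 0 := by positivity
  field_simp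
  rw [hk]
  ring

lemma F_eq (k : ℝ) : ∫ z, stdPhi z * stdPhi (k * z) ∂γ
    = 1 / 4 + (2 * Real.pi)⁻¹ * Real.arctan (k / √(2 + k ^ 2)) := by
  have h := is_const_of_deriv_eq_zero
    (f := (fun k => ∫ z, stdPhi z * stdPhi (k * z) ∂γ) -
      fun k => (2 * Real.pi)⁻¹ * Real.arctan (k / √(2 + k ^ 2)))
    (fun x => ((F_deriv x).sub (G_deriv x)).differentiableAt)
    (fun x => by rw [((F_deriv x).sub (G_deriv x)).deriv, sub_self]) k 0
  simp only [Pi.sub_apply, zero_mul, zero_div, Real.arctan_zero, mul_zero, sub_zero] at h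
  have h0 : stdPhi 0 = 1 / 2 := by
    have := stdPhi_neg 0
    rw [neg_zero] at this; linarith
  have h1 := int_stdPhi_mul 1
  simp only [one_mul] at h1
  rw [integral_mul_const, h1, h0] at h
  linarith

/-- For independent standard normals `Z, W`, `r ∈ [-1,1]` and
`Z₂ = r Z + √(1-r²) W`, one has `Cov(Φ(Z), Φ(Z₂)) = arcsin(r/2)/(2π)`; equivalently, with
`ρ = 12 Cov(Φ(Z), Φ(Z₂))` the population Spearman rho, `r = 2 sin(πρ/6)`. -/
theorem stmt12 {Ω : Type*} [MeasurableSpace Ω] (μ : Measure Ω) [IsProbabilityMeasure μ]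
    (Z W : Ω → ℝ) (hZ : Measurable Z) (hW : Measurable W)
    (hZlaw : μ.map Z = gaussianReal 0 1) (hWlaw : μ.map W = gaussianReal 0 1)
    (hindep : IndepFun Z W μ) (r : ℝ) (hr : r ∈ Set.Icc (-1 : ℝ) 1) :
    covPhi μ Z (fun ω => r * Z ω + Real.sqrt (1 - r ^ 2) * W ω) =
        Real.arcsin (r / 2) / (2 * Real.pi) ∧
      r = 2 * Real.sin (Real.pi *
            (12 * covPhi μ Z (fun ω => r * Z ω + Real.sqrt (1 - r ^ 2) * W ω)) / 6) := by
  have hr2 : r ^ 2 ≤ 1 := by nlinarith [hr.1, hr.2]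
  set s := √(1 - r ^ 2) with hs
  have hs2 : 1 + s ^ 2 = 2 - r ^ 2 := by
    rw [hs, Real.sq_sqrt (by linarith)]; ring
  set k := r / √(1 + s ^ 2) with hk
  have hkz : ∀ z, (r * z) / √(1 + s ^ 2) = k * z := fun z => by rw [hk]; ring
  have hjoint : μ.map (fun ω => (Z ω, W ω)) = (γ).prod γ := by
    rw [hindep.map_prod_eq_prod_map_map hZ.aemeasurable hW.aemeasurable, hZlaw, hWlaw]
  have key : ∀ f : ℝ → ℝ, Continuous f → (∀ x, ‖f x‖ ≤ 1) →
      ∫ ω, f (Z ω) * stdPhi (r * Z ω + s * W ω) ∂μ = ∫ z, f z * stdPhi (k * z) ∂γ := by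
    intro f hf hb
    have hc : Continuous (fun p : ℝ × ℝ => f p.1 * stdPhi (r * p.1 + s * p.2)) :=
      (hf.comp continuous_fst).mul (stdPhi_cont.comp (by fun_prop))
    have h1 : ∫ ω, f (Z ω) * stdPhi (r * Z ω + s * W ω) ∂μ
        = ∫ p, f p.1 * stdPhi (r * p.1 + s * p.2) ∂((γ).prod γ) := by
      rw [← hjoint, integral_map (by fun_prop) hc.aestronglyMeasurable]
    rw [h1, integral_prod]
    · simp_rw [integral_const_mul, stdPhi_conv, hkz]
    · refine Integrable.of_bound hc.aestronglyMeasurable 1 (ae_of_all _ fun z => ?_)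
      rw [norm_mul]
      exact mul_le_one₀ (hb _) (norm_nonneg _) (stdPhi_norm _)
  have hcov : covPhi μ Z (fun ω => r * Z ω + s * W ω) = Real.arcsin (r / 2) / (2 * Real.pi) := by
    unfold covPhi
    have m1 : ∫ ω, stdPhi (Z ω) ∂μ = 1 / 2 := by
      have := int_stdPhi_mul 1
      simp only [one_mul] at this
      rw [← this, ← hZlaw, integral_map hZ.aemeasurable stdPhi_cont.aestronglyMeasurable]
    have m2 : ∫ ω, stdPhi (r * Z ω + s * W ω) ∂μ = 1 / 2 := by
      have := key (fun _ => 1) continuous_const (by simp)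
      simpa [int_stdPhi_mul] using this
    rw [key stdPhi stdPhi_cont stdPhi_norm, m1, m2, F_eq]
    have hp : 0 < 2 - r ^ 2 := by linarith
    have harg : k / √(2 + k ^ 2) = (r / 2) / √(1 - (r / 2) ^ 2) := by
      have hk2 : 2 + k ^ 2 = (1 - (r / 2) ^ 2) * (2 ^ 2 / (2 - r ^ 2)) := by
        rw [hk, div_pow, hs2, Real.sq_sqrt hp.le]; field_simp; ring
      rw [hk2, Real.sqrt_mul (by nlinarith), Real.sqrt_div (by positivity),
        Real.sqrt_sq (by norm_num), hk, hs2]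
      have := (Real.sqrt_pos.2 hp).ne'
      have h9 : √(1 - (r / 2) ^ 2) ≠ 0 := (Real.sqrt_pos.2 (by nlinarith)).ne'
      field_simp
    rw [harg, ← Real.arcsin_eq_arctan ⟨by linarith [hr.1], by linarith [hr.2]⟩]
    ring
  refine ⟨hcov, ?_⟩
  rw [hcov]
  have : Real.pi * (12 * (Real.arcsin (r / 2) / (2 * Real.pi))) / 6 = Real.arcsin (r / 2) := by
    field_simp; ring
  rw [this, Real.sin_arcsin (by linarith [hr.1]) (by linarith [hr.2])]
  ring
end

section
/- Let Z and W be independent standard normal random variables, and fix a, b ∈ ℝ. Then the function r ↦ P(Z ≤ a and r·Z + √(1−r²)·W ≤ b) is strictly increasing on [−1, 1]. -/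
open MeasureTheory ProbabilityTheory

noncomputable def sliceG (b r z : ℝ) : ℝ :=
  (gaussianReal 0 1).real {w | r * z + Real.sqrt (1 - r ^ 2) * w ≤ b}

lemma gauss_Ioc_pos {x y : ℝ} (h : x < y) : 0 < (gaussianReal 0 1).real (Set.Ioc x y) := by
  rw [measureReal_def, ENNReal.toReal_pos_iff]
  refine ⟨pos_iff_ne_zero.2 fun h0 => ?_, measure_lt_top _ _⟩
  have := gaussianReal_absolutelyContinuous' 0 (one_ne_zero) h0
  simp at this
  linarith

lemma gauss_Iic_strict : StrictMono fun x : ℝ => (gaussianReal 0 1).real (Set.Iic x) := by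
  intro x y h
  have := gauss_Ioc_pos h
  have h2 : (gaussianReal 0 1).real (Set.Iic x ∪ Set.Ioc x y)
      = (gaussianReal 0 1).real (Set.Iic x) + (gaussianReal 0 1).real (Set.Ioc x y) :=
    measureReal_union (Set.Iic_disjoint_Ioc le_rfl) measurableSet_Ioc
  rw [Set.Iic_union_Ioc_eq_Iic h.le] at h2
  simp only
  linarith

lemma gauss_Iic_pos (x : ℝ) : 0 < (gaussianReal 0 1).real (Set.Iic x) :=
  lt_of_le_of_lt measureReal_nonneg (gauss_Iic_strict (sub_one_lt x))

lemma gauss_Iic_lt (x : ℝ) : (gaussianReal 0 1).real (Set.Iic x) < 1 :=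
  lt_of_lt_of_le (gauss_Iic_strict (lt_add_one x)) measureReal_le_one

lemma sliceG_int {b r : ℝ} (h1 : -1 < r) (h2 : r < 1) (z : ℝ) :
    sliceG b r z = (gaussianReal 0 1).real
      (Set.Iic (b / Real.sqrt (1 - r ^ 2) - r / Real.sqrt (1 - r ^ 2) * z)) := by
  have h : 0 < Real.sqrt (1 - r ^ 2) := Real.sqrt_pos.2 (by nlinarith)
  unfold sliceG
  congr 1
  ext w
  have : b / Real.sqrt (1 - r ^ 2) - r / Real.sqrt (1 - r ^ 2) * z
    = (b - r * z) / Real.sqrt (1 - r ^ 2) := by field_simp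
  simp only [Set.mem_setOf_eq, Set.mem_Iic, this, le_div_iff₀ h]
  constructor <;> intro h <;> linarith

lemma sliceG_one (b z : ℝ) : sliceG b 1 z = if z ≤ b then 1 else 0 := by
  unfold sliceG
  split_ifs with h <;> simp [h]

lemma sliceG_neg_one (b z : ℝ) : sliceG b (-1) z = if -b ≤ z then 1 else 0 := by
  unfold sliceG
  have : -z ≤ b ↔ -b ≤ z := by constructor <;> intro h <;> linarith
  split_ifs with h <;> simp [h, this]

lemma crossing (b : ℝ) {r s : ℝ} (hr : -1 ≤ r) (hrs : r < s) (hs : s ≤ 1)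
    (hn : -1 < r ∨ s < 1) :
    ∃ z0, (∀ z < z0, sliceG b r z < sliceG b s z) ∧ (∀ z > z0, sliceG b s z < sliceG b r z) := by
  rcases hs.eq_or_lt with rfl | hs
  · have hr : -1 < r := by simpa using hn
    refine ⟨b, fun z hz => ?_, fun z hz => ?_⟩
    · rw [sliceG_one, if_pos hz.le, sliceG_int hr hrs]; exact gauss_Iic_lt _
    · rw [sliceG_one, if_neg (not_le.2 hz), sliceG_int hr hrs]; exact gauss_Iic_pos _
  rcases hr.eq_or_lt with rfl | hr
  · refine ⟨-b, fun z hz => ?_, fun z hz => ?_⟩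
    · rw [sliceG_neg_one, if_neg (not_le.2 hz), sliceG_int hrs hs]; exact gauss_Iic_pos _
    · rw [sliceG_neg_one, if_pos (le_of_lt hz), sliceG_int hrs hs]; exact gauss_Iic_lt _
  have hk : r / Real.sqrt (1 - r ^ 2) < s / Real.sqrt (1 - s ^ 2) := by
    rw [← Real.tan_arcsin, ← Real.tan_arcsin]
    apply Real.strictMonoOn_tan
    · exact ⟨Real.neg_pi_div_two_lt_arcsin.2 hr, Real.arcsin_lt_pi_div_two.2 (by linarith)⟩
    · exact ⟨Real.neg_pi_div_two_lt_arcsin.2 (by linarith), Real.arcsin_lt_pi_div_two.2 hs⟩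
    · exact Real.strictMonoOn_arcsin ⟨hr.le, by linarith⟩ ⟨by linarith, hs.le⟩ hrs
  have hk' := sub_pos.2 hk
  refine ⟨(b / Real.sqrt (1 - s ^ 2) - b / Real.sqrt (1 - r ^ 2)) /
    (s / Real.sqrt (1 - s ^ 2) - r / Real.sqrt (1 - r ^ 2)), fun z hz => ?_, fun z hz => ?_⟩
  · rw [lt_div_iff₀ hk'] at hz
    rw [sliceG_int hr (by linarith), sliceG_int (by linarith) hs]
    exact gauss_Iic_strict (by linarith)
  · rw [gt_iff_lt, div_lt_iff₀ hk'] at hz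
    rw [sliceG_int hr (by linarith), sliceG_int (by linarith) hs]
    exact gauss_Iic_strict (by linarith)

lemma meas_ev (b r : ℝ) :
    MeasurableSet {p : ℝ × ℝ | r * p.1 + Real.sqrt (1 - r ^ 2) * p.2 ≤ b} :=
  measurableSet_le (by fun_prop) (by fun_prop)

lemma sliceG_meas (b r : ℝ) : Measurable (sliceG b r) :=
  (measurable_measure_prodMk_left (ν := gaussianReal 0 1) (meas_ev b r)).ennreal_toReal

lemma sliceG_integrable (b r : ℝ) : Integrable (sliceG b r) (gaussianReal 0 1) := by
  refine Integrable.of_bound (C := 1) (sliceG_meas b r).aestronglyMeasurable (.of_forall fun z => ?_)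
  rw [sliceG, Real.norm_of_nonneg measureReal_nonneg]
  exact measureReal_le_one

lemma setInt_pos {f : ℝ → ℝ} (hf : Integrable f (gaussianReal 0 1)) {S : Set ℝ}
    (hS : MeasurableSet S) {u v : ℝ} (huv : u < v) (huS : Set.Ioc u v ⊆ S)
    (h : ∀ᵐ z ∂(gaussianReal 0 1).restrict S, 0 < f z) :
    0 < ∫ z in S, f z ∂(gaussianReal 0 1) := by
  rw [integral_pos_iff_support_of_nonneg_ae (h.mono fun _ h => h.le) hf.integrableOn]
  refine pos_iff_ne_zero.2 fun h0 => ?_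
  have h1 : ∀ᵐ z ∂(gaussianReal 0 1).restrict S, z ∉ Function.support f :=
    measure_eq_zero_iff_ae_notMem.1 h0
  have h2 : ∀ᵐ z ∂(gaussianReal 0 1).restrict S, False := by
    filter_upwards [h, h1] with z h h1
    exact h1 h.ne'
  have h3 : (gaussianReal 0 1) S = 0 := by
    simpa using h2
  have := gauss_Ioc_pos huv
  rw [measureReal_def, measure_mono_null huS h3] at this
  simp at this

lemma key {b r s : ℝ} (hr : -1 ≤ r) (hrs : r < s) (hs : s ≤ 1)
    (hn : -1 < r ∨ s < 1) (a : ℝ)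
    (htot : ∫ z, sliceG b r z ∂(gaussianReal 0 1) = ∫ z, sliceG b s z ∂(gaussianReal 0 1)) :
    ∫ z in Set.Iic a, sliceG b r z ∂(gaussianReal 0 1)
      < ∫ z in Set.Iic a, sliceG b s z ∂(gaussianReal 0 1) := by
  obtain ⟨z0, hl, hg⟩ := crossing b hr hrs hs hn
  have ir := sliceG_integrable b r
  have is := sliceG_integrable b s
  rcases le_or_gt a z0 with ha | ha
  · have : 0 < ∫ z in Set.Iic a, (sliceG b s z - sliceG b r z) ∂(gaussianReal 0 1) := by
      refine setInt_pos (is.sub ir) measurableSet_Iic (sub_one_lt a) Set.Ioc_subset_Iic_self ?_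
      have := nullSingletonClass_gaussianReal (μ := 0) (v := 1) one_ne_zero
      rw [← restrict_Iio_eq_restrict_Iic]
      refine ae_restrict_of_forall_mem measurableSet_Iio fun z hz => sub_pos.2 (hl z ?_)
      exact lt_of_lt_of_le hz ha
    rw [integral_sub is.integrableOn ir.integrableOn] at this
    linarith
  · have : 0 < ∫ z in (Set.Iic a)ᶜ, (sliceG b r z - sliceG b s z) ∂(gaussianReal 0 1) := by
      refine setInt_pos (ir.sub is) measurableSet_Iic.compl (lt_add_one a)
        (by rw [Set.compl_Iic]; exact Set.Ioc_subset_Ioi_self) ?_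
      refine ae_restrict_of_forall_mem measurableSet_Iic.compl fun z hz => sub_pos.2 (hg z ?_)
      exact ha.trans (by simpa using hz)
    rw [integral_sub ir.integrableOn is.integrableOn] at this
    have e1 := integral_add_compl (measurableSet_Iic (a := a)) ir
    have e2 := integral_add_compl (measurableSet_Iic (a := a)) is
    linarith

lemma prob_eq {Ω : Type*} [MeasurableSpace Ω] (μ : Measure Ω) [IsProbabilityMeasure μ]
    (Z W : Ω → ℝ) (hZ : Measurable Z) (hW : Measurable W)
    (hZlaw : μ.map Z = gaussianReal 0 1) (hWlaw : μ.map W = gaussianReal 0 1)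
    (hindep : IndepFun Z W μ) (b r : ℝ) {A : Set ℝ} (hA : MeasurableSet A) :
    (μ {ω | Z ω ∈ A ∧ r * Z ω + Real.sqrt (1 - r ^ 2) * W ω ≤ b}).toReal
      = ∫ z in A, sliceG b r z ∂(gaussianReal 0 1) := by
  have hm := (indepFun_iff_map_prod_eq_prod_map_map hZ.aemeasurable hW.aemeasurable).1 hindep
  rw [hZlaw, hWlaw] at hm
  have hT : MeasurableSet ({p : ℝ × ℝ | p.1 ∈ A ∧ r * p.1 + Real.sqrt (1 - r ^ 2) * p.2 ≤ b}) :=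
    (measurable_fst hA).inter (meas_ev b r)
  have h1 : μ {ω | Z ω ∈ A ∧ r * Z ω + Real.sqrt (1 - r ^ 2) * W ω ≤ b}
      = ((gaussianReal 0 1).prod (gaussianReal 0 1))
        {p : ℝ × ℝ | p.1 ∈ A ∧ r * p.1 + Real.sqrt (1 - r ^ 2) * p.2 ≤ b} := by
    rw [← hm, Measure.map_apply (hZ.prodMk hW) hT]
    rfl
  rw [h1, Measure.prod_apply hT, ← integral_indicator hA, ← integral_toReal]
  · refine integral_congr_ae (.of_forall fun z => ?_)
    by_cases hz : z ∈ A
    · simp [hz, sliceG, measureReal_def]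
    · simp [hz]
  · exact (measurable_measure_prodMk_left hT).aemeasurable
  · exact .of_forall fun z => measure_lt_top _ _

lemma total {Ω : Type*} [MeasurableSpace Ω] (μ : Measure Ω) [IsProbabilityMeasure μ]
    (Z W : Ω → ℝ) (hZ : Measurable Z) (hW : Measurable W)
    (hZlaw : μ.map Z = gaussianReal 0 1) (hWlaw : μ.map W = gaussianReal 0 1)
    (hindep : IndepFun Z W μ) (b r : ℝ) (h1 : -1 ≤ r) (h2 : r ≤ 1) :
    ∫ z, sliceG b r z ∂(gaussianReal 0 1) = (gaussianReal 0 1).real (Set.Iic b) := by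
  have h := prob_eq μ Z W hZ hW hZlaw hWlaw hindep b r MeasurableSet.univ
  rw [Measure.restrict_univ] at h
  rw [← h]
  have l1 : μ.map (fun ω => r * Z ω) = gaussianReal (r * 0) (NNReal.mk (r ^ 2) (sq_nonneg _) * 1) := by
    rw [← gaussianReal_map_const_mul, ← hZlaw, Measure.map_map (by fun_prop) hZ]; rfl
  have l2 : μ.map (fun ω => Real.sqrt (1 - r ^ 2) * W ω) = gaussianReal (Real.sqrt (1 - r ^ 2) * 0)
      (NNReal.mk (Real.sqrt (1 - r ^ 2) ^ 2) (sq_nonneg _) * 1) := by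
    rw [← gaussianReal_map_const_mul, ← hWlaw, Measure.map_map (by fun_prop) hW]; rfl
  have hi : IndepFun (fun ω => r * Z ω) (fun ω => Real.sqrt (1 - r ^ 2) * W ω) μ :=
    hindep.comp (φ := fun x => r * x) (ψ := fun x => Real.sqrt (1 - r ^ 2) * x)
      (by fun_prop) (by fun_prop)
  have l3 := gaussianReal_add_gaussianReal_of_indepFun hi l1 l2
  have hv : ((NNReal.mk (r ^ 2) (sq_nonneg _) * 1 + NNReal.mk (Real.sqrt (1 - r ^ 2) ^ 2) (sq_nonneg _) * 1 : NNReal))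
      = 1 := by
    ext
    have := Real.sq_sqrt (show 0 ≤ 1 - r ^ 2 by nlinarith)
    simp [this]
  rw [hv, mul_zero, mul_zero, add_zero] at l3
  rw [← l3, measureReal_def, Measure.map_apply (by fun_prop) measurableSet_Iic]
  simp [Set.preimage]

open MeasureTheory ProbabilityTheory

/-- For independent standard normals `Z, W` and fixed `a, b ∈ ℝ`, the
bivariate normal lower-quadrant probability
`r ↦ P(Z ≤ a ∧ r Z + √(1-r²) W ≤ b)` is strictly increasing on `[-1, 1]`. -/
theorem stmt13 {Ω : Type*} [MeasurableSpace Ω] (μ : Measure Ω) [IsProbabilityMeasure μ]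
    (Z W : Ω → ℝ) (hZ : Measurable Z) (hW : Measurable W)
    (hZlaw : μ.map Z = gaussianReal 0 1) (hWlaw : μ.map W = gaussianReal 0 1)
    (hindep : IndepFun Z W μ) (a b : ℝ) :
    StrictMonoOn
      (fun r : ℝ =>
        (μ {ω | Z ω ≤ a ∧ r * Z ω + Real.sqrt (1 - r ^ 2) * W ω ≤ b}).toReal)
      (Set.Icc (-1 : ℝ) 1) := by
  have P : ∀ r, (μ {ω | Z ω ≤ a ∧ r * Z ω + Real.sqrt (1 - r ^ 2) * W ω ≤ b}).toReal
      = ∫ z in Set.Iic a, sliceG b r z ∂(gaussianReal 0 1) := fun r =>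
    prob_eq μ Z W hZ hW hZlaw hWlaw hindep b r measurableSet_Iic
  have T := fun r => total μ Z W hZ hW hZlaw hWlaw hindep b r
  have K : ∀ r s, -1 ≤ r → r < s → s ≤ 1 → (-1 < r ∨ s < 1) →
      ∫ z in Set.Iic a, sliceG b r z ∂(gaussianReal 0 1)
        < ∫ z in Set.Iic a, sliceG b s z ∂(gaussianReal 0 1) := fun r s hr hrs hs hn =>
    key hr hrs hs hn a ((T r hr (by linarith)).trans (T s (by linarith) hs).symm)
  rintro r ⟨hr, -⟩ s ⟨-, hs⟩ hrs
  simp only [P]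
  by_cases hn : -1 < r ∨ s < 1
  · exact K r s hr hrs hs hn
  · push Not at hn
    exact (K r 0 hr (by linarith) (by norm_num) (.inr (by norm_num))).trans
      (K 0 s (by norm_num) (by linarith) hs (.inl (by norm_num)))
end
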